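/- Let R be a commutative Noetherian ring and let (𝒯,ℱ) be a torsion pair in R-Mod. Then (𝒯,ℱ) is a hereditary torsion pair if and only if ℱ is closed under direct limits. -/

import Mathlib

open CategoryTheory Limits DirectSum

universe w u

variable (R : Type u) [CommRing R]

/-- A torsion pair `(T, F)` in the category of left `R`-modules: both classes are closed
under isomorphism, all homomorphisms from `T` to `F` vanish, and every module has a
torsion submodule in `T` with torsion-free quotient in `F`. -/
structure ModTorsionPair (T F : ModuleCat.{u} R → Prop) : Prop where
  iso_closed_torsion : ∀ {M N : ModuleCat.{u} R}, (M ≅ N) → T M → T N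
  iso_closed_torsionfree : ∀ {M N : ModuleCat.{u} R}, (M ≅ N) → F M → F N
  hom_eq_zero : ∀ {M N : ModuleCat.{u} R}, T M → F N → ∀ f : M →ₗ[R] N, f = 0
  exists_torsion_submodule : ∀ M : ModuleCat.{u} R, ∃ t : Submodule R M,
    T (ModuleCat.of R t) ∧ F (ModuleCat.of R (M ⧸ t))

/-- A class of modules is hereditary (closed under submodules). -/
def HereditaryClass (T : ModuleCat.{u} R → Prop) : Prop :=
  ∀ M : ModuleCat.{u} R, T M → ∀ N : Submodule R M, T (ModuleCat.of R N)

/-- A class of modules is closed under direct limits (filtered colimits). -/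
def ClosedUnderDirectLimits (F : ModuleCat.{u} R → Prop) : Prop :=
  ∀ (J : Type u) [SmallCategory J] [IsFiltered J] (D : J ⥤ ModuleCat.{u} R)
    (c : Cocone D), IsColimit c → (∀ j, F (D.obj j)) → F c.pt

/-- A module is left orthogonal to a class `F` if all linear maps into members of `F` vanish. -/
def IsLeftOrthogonal (F : ModuleCat.{u} R → Prop) (X : Type u) [AddCommGroup X] [Module R X] :
    Prop :=
  ∀ Y : ModuleCat.{u} R, F Y → ∀ f : X →ₗ[R] Y, f = 0

variable {R}

namespace IsLeftOrthogonal

variable {F : ModuleCat.{u} R → Prop} {X Y Z : Type u} [AddCommGroup X] [Module R X]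
  [AddCommGroup Y] [Module R Y] [AddCommGroup Z] [Module R Z]

theorem of_surjective (hX : IsLeftOrthogonal R F X) (f : X →ₗ[R] Y)
    (hf : Function.Surjective f) : IsLeftOrthogonal R F Y := by
  intro W hW g
  ext y
  obtain ⟨x, rfl⟩ := hf y
  exact LinearMap.congr_fun (hX W hW (g ∘ₗ f)) x

theorem of_exact (hX : IsLeftOrthogonal R F X) (hZ : IsLeftOrthogonal R F Z) (f : X →ₗ[R] Y)
    (g : Y →ₗ[R] Z) (hg : Function.Surjective g) (hfg : Function.Exact f g) :
    IsLeftOrthogonal R F Y := by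
  intro W hW k
  have hker : LinearMap.ker g ≤ LinearMap.ker k := by
    intro y hy
    obtain ⟨x, rfl⟩ := (hfg y).mp hy
    exact LinearMap.congr_fun (hX W hW (k ∘ₗ f)) x
  have hquot : IsLeftOrthogonal R F (Y ⧸ LinearMap.ker g) :=
    hZ.of_surjective (g.quotKerEquivOfSurjective hg).symm.toLinearMap
      (g.quotKerEquivOfSurjective hg).symm.surjective
  ext y
  exact LinearMap.congr_fun (hquot W hW ((LinearMap.ker g).liftQ k hker)) (Submodule.Quotient.mk y)

theorem of_subsingleton [Subsingleton X] : IsLeftOrthogonal R F X := by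
  intro W _ f
  ext x
  rw [Subsingleton.elim x 0, map_zero, map_zero]

/-- A finite module over a Noetherian ring is left orthogonal to `F` as soon as the quotients by
all primes in its support are. -/
theorem of_forall_prime [IsNoetherianRing R] [Module.Finite R X]
    (h : ∀ p : PrimeSpectrum R, p ∈ Module.support R X →
      IsLeftOrthogonal R F (R ⧸ p.asIdeal)) : IsLeftOrthogonal R F X := by
  induction ‹Module.Finite R X› using
    IsNoetherianRing.induction_on_isQuotientEquivQuotientPrime R with
  | subsingleton N => exact of_subsingleton
  | quotient N p e =>
    refine (h p ?_).of_surjective e.symm.toLinearMap e.symm.surjective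
    rw [e.support_eq, Module.mem_support_iff_of_finite, Ideal.annihilator_quotient]
  | exact N₁ N₂ N₃ f g hf hg hfg h₁ h₃ =>
    rw [Module.support_of_exact hfg hf hg] at h
    exact of_exact (h₁ fun p hp ↦ h p (.inl hp)) (h₃ fun p hp ↦ h p (.inr hp)) f g hg hfg

end IsLeftOrthogonal

/-- A finite module over a Noetherian ring maps nontrivially to `R ⧸ p` for each prime `p` in its
support. -/
theorem Module.exists_linearMap_quotient_ne_zero_of_mem_support [IsNoetherianRing R] {M : Type u}
    [AddCommGroup M] [Module R M] [Module.Finite R M] {p : PrimeSpectrum R}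
    (hp : p ∈ Module.support R M) : ∃ f : M →ₗ[R] R ⧸ p.asIdeal, f ≠ 0 := by
  let P := p.asIdeal
  let A := Localization.AtPrime P
  let L := LocalizedModule P.primeCompl M
  have : Nontrivial L := hp
  have hnt : Nontrivial (TensorProduct A P.ResidueField L) := by
    rw [← not_subsingleton_iff_nontrivial, IsLocalRing.subsingleton_tensorProduct,
      not_subsingleton_iff_nontrivial]
    exact this
  obtain ⟨v, hv⟩ := exists_ne (0 : TensorProduct A P.ResidueField L)
  obtain ⟨l, rfl⟩ := TensorProduct.mk_surjective A L P.ResidueField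
    IsLocalRing.residue_surjective v
  obtain ⟨φ, hφ⟩ := Module.Projective.exists_dual_ne_zero P.ResidueField hv
  let g : M →ₗ[R] P.ResidueField :=
    ((φ.restrictScalars A ∘ₗ TensorProduct.mk A P.ResidueField L 1).restrictScalars R) ∘ₗ
      LocalizedModule.mkLinearMap P.primeCompl M
  have hinj (s : P.primeCompl) {z : P.ResidueField} : (s : R) • z = 0 ↔ z = 0 := by
    rw [Algebra.smul_def, mul_eq_zero, Ideal.algebraMap_residueField_eq_zero]
    exact or_iff_right s.2
  have hg : g ≠ 0 := by
    intro hg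
    apply hφ
    let ψ := (φ.restrictScalars A ∘ₗ TensorProduct.mk A P.ResidueField L 1).restrictScalars R
    obtain ⟨⟨m, s⟩, hms⟩ := IsLocalizedModule.surj P.primeCompl
      (LocalizedModule.mkLinearMap P.primeCompl M) l
    have hψ : (s : R) • ψ l = 0 := by
      rw [← map_smul]
      exact (congrArg ψ hms).trans (LinearMap.congr_fun hg m)
    exact (hinj s).mp hψ
  have hsub : Algebra.algebraMapSubmonoid (R ⧸ P) P.primeCompl = nonZeroDivisors (R ⧸ P) := by
    ext z
    obtain ⟨a, rfl⟩ := Ideal.Quotient.mk_surjective z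
    rw [mem_nonZeroDivisors_iff_ne_zero, Ne, Ideal.Quotient.eq_zero_iff_mem]
    refine ⟨?_, fun ha ↦ ⟨a, ha, rfl⟩⟩
    rintro ⟨b, hb, hab⟩ ha
    refine hb (Ideal.Quotient.eq_zero_iff_mem.mp (hab.trans ?_))
    exact Ideal.Quotient.eq_zero_iff_mem.mpr ha
  have hloc : IsLocalizedModule (Algebra.algebraMapSubmonoid (R ⧸ P) P.primeCompl)
      (Algebra.linearMap (R ⧸ P) P.ResidueField) := by
    rw [hsub]; infer_instance
  have := IsLocalizedModule.restrictScalars P.primeCompl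
    (Algebra.linearMap (R ⧸ P) P.ResidueField)
  have := Module.finitePresentation_of_finite R M
  obtain ⟨h, s, hs⟩ := Module.FinitePresentation.exists_lift_of_isLocalizedModule P.primeCompl
    ((Algebra.linearMap (R ⧸ P) P.ResidueField).restrictScalars R) g
  refine ⟨h, fun h0 ↦ hg ?_⟩
  rw [h0, LinearMap.comp_zero] at hs
  ext m
  exact (hinj s).mp (LinearMap.congr_fun hs m).symm

theorem IsLeftOrthogonal.quotient_prime [IsNoetherianRing R] {F : ModuleCat.{u} R → Prop}
    {M : Type u} [AddCommGroup M] [Module R M] [Module.Finite R M]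
    (hM : IsLeftOrthogonal R F M) (p : PrimeSpectrum R) (hp : p ∈ Module.support R M) :
    IsLeftOrthogonal R F (R ⧸ p.asIdeal) := by
  have : WellFoundedGT (PrimeSpectrum R) :=
    StrictMono.wellFoundedGT (f := PrimeSpectrum.asIdeal) fun _ _ h ↦ h
  induction p using WellFoundedGT.induction with
  | ind p ih =>
  obtain ⟨f, hf⟩ := Module.exists_linearMap_quotient_ne_zero_of_mem_support hp
  have hrange : IsLeftOrthogonal R F (LinearMap.range f) :=
    hM.of_surjective f.rangeRestrict f.surjective_rangeRestrict
  refine hrange.of_exact ?_ (LinearMap.range f).subtype (LinearMap.range f).mkQ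
    (Submodule.mkQ_surjective _) (LinearMap.exact_subtype_mkQ _)
  refine IsLeftOrthogonal.of_forall_prime fun q hq ↦ ?_
  have hmem (a : R) (ha : Ideal.Quotient.mk p.asIdeal a ∈ LinearMap.range f) : a ∈ q.asIdeal := by
    refine Module.annihilator_le_of_mem_support hq (Module.mem_annihilator.mpr fun z ↦ ?_)
    obtain ⟨y, rfl⟩ := Submodule.mkQ_surjective _ z
    obtain ⟨b, rfl⟩ := Ideal.Quotient.mk_surjective y
    rw [← map_smul, Submodule.mkQ_apply, Submodule.Quotient.mk_eq_zero]
    have hab : a • Ideal.Quotient.mk p.asIdeal b = b • Ideal.Quotient.mk p.asIdeal a := by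
      rw [Algebra.smul_def, Algebra.smul_def, mul_comm]
      rfl
    rw [hab]
    exact Submodule.smul_mem _ b ha
  have hle : p ≤ q := fun a ha ↦ hmem a <| by
    rw [Ideal.Quotient.eq_zero_iff_mem.mpr ha]
    exact Submodule.zero_mem _
  have hlt : p < q := by
    refine lt_of_le_of_ne hle ?_
    rintro rfl
    refine hf (LinearMap.ext fun m ↦ ?_)
    obtain ⟨a, ha⟩ := Ideal.Quotient.mk_surjective (f m)
    rw [← ha, LinearMap.zero_apply, Ideal.Quotient.eq_zero_iff_mem]
    exact hmem a (ha ▸ LinearMap.mem_range_self f m)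
  exact ih q hlt (Module.mem_support_mono hlt.le hp)

theorem IsLeftOrthogonal.of_injective_of_finite [IsNoetherianRing R] {F : ModuleCat.{u} R → Prop}
    {M N : Type u} [AddCommGroup M] [Module R M] [Module.Finite R M] [AddCommGroup N] [Module R N]
    (hM : IsLeftOrthogonal R F M) (f : N →ₗ[R] M) (hf : Function.Injective f) :
    IsLeftOrthogonal R F N :=
  have := Module.Finite.of_injective f hf
  .of_forall_prime fun p hp ↦
    hM.quotient_prime p (Module.support_subset_of_injective f hf hp)

/-- In a filtered colimit of modules, finitely many scalars annihilating the image of an element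
already annihilate its image at some stage. -/
theorem exists_map_eq_zero_of_forall_mem {J : Type u} [SmallCategory J] [IsFiltered J]
    {D : J ⥤ ModuleCat.{u} R} {c : Cocone D} (hc : IsColimit c) {j : J} (y : D.obj j)
    (s : Finset R) (hs : ∀ a ∈ s, c.ι.app j (a • y) = 0) :
    ∃ (k : J) (f : j ⟶ k), ∀ a ∈ s, a • D.map f y = 0 := by
  classical
  induction s using Finset.induction_on with
  | empty => exact ⟨j, 𝟙 j, fun a ha ↦ absurd ha (Finset.notMem_empty a)⟩
  | insert a s _ ih =>
    obtain ⟨k, f, hf⟩ := ih fun b hb ↦ hs b (Finset.mem_insert_of_mem hb)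
    have hzero : c.ι.app k (a • D.map f y) = c.ι.app k 0 := by
      rw [map_zero, ← map_smul, ← ConcreteCategory.comp_apply, c.w]
      exact hs a (Finset.mem_insert_self a s)
    obtain ⟨l, g, g', hg⟩ := Concrete.isColimit_exists_of_rep_eq D hc _ _ hzero
    refine ⟨l, f ≫ g, fun b hb ↦ ?_⟩
    rw [D.map_comp, ConcreteCategory.comp_apply, ← map_smul]
    obtain rfl | hb := Finset.mem_insert.mp hb
    · rw [hg, map_zero]
    · rw [hf b hb, map_zero]

namespace ModTorsionPair

variable {T F : ModuleCat.{u} R → Prop}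

theorem isLeftOrthogonal (htp : ModTorsionPair R T F) {M : ModuleCat.{u} R} (hM : T M) :
    IsLeftOrthogonal R F M :=
  fun _ hY f ↦ htp.hom_eq_zero hM hY f

theorem torsion_of_isLeftOrthogonal (htp : ModTorsionPair R T F) {M : ModuleCat.{u} R}
    (hM : IsLeftOrthogonal R F M) : T M := by
  obtain ⟨t, ht, hF⟩ := htp.exists_torsion_submodule M
  have htop : t = ⊤ := by
    rw [← t.ker_mkQ, hM _ hF t.mkQ, LinearMap.ker_zero]
  subst htop
  exact htp.iso_closed_torsion (Submodule.topEquiv.toModuleIso) ht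

theorem torsionfree_of_forall (htp : ModTorsionPair R T F) {M : ModuleCat.{u} R}
    (hM : ∀ t : Submodule R M, T (ModuleCat.of R t) → t = ⊥) : F M := by
  obtain ⟨t, ht, hF⟩ := htp.exists_torsion_submodule M
  obtain rfl := hM t ht
  exact htp.iso_closed_torsionfree (Submodule.quotEquivOfEqBot ⊥ rfl).toModuleIso hF

theorem closedUnderDirectLimits [IsNoetherianRing R] (htp : ModTorsionPair R T F)
    (hT : HereditaryClass R T) : ClosedUnderDirectLimits R F := by
  intro J _ _ D c hc hD
  refine htp.torsionfree_of_forall fun t ht ↦ (Submodule.eq_bot_iff _).mpr fun x hx ↦ ?_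
  obtain ⟨j, y, rfl⟩ := Concrete.isColimit_exists_rep D hc x
  let φ : R →ₗ[R] t := LinearMap.toSpanSingleton R t ⟨c.ι.app j y, hx⟩
  have hquot : IsLeftOrthogonal R F (R ⧸ LinearMap.ker φ) :=
    (htp.isLeftOrthogonal (hT _ ht (LinearMap.range φ))).of_surjective
      φ.quotKerEquivRange.symm.toLinearMap φ.quotKerEquivRange.symm.surjective
  obtain ⟨s, hs⟩ := IsNoetherian.noetherian (LinearMap.ker φ)
  have hzero (a : R) (ha : a ∈ s) : c.ι.app j (a • y) = 0 := by
    have : a ∈ LinearMap.ker φ := hs ▸ Submodule.subset_span ha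
    rw [map_smul]
    exact congrArg Subtype.val (LinearMap.mem_ker.mp this)
  obtain ⟨k, f, hf⟩ := exists_map_eq_zero_of_forall_mem hc y s hzero
  have hker : LinearMap.ker φ ≤
      LinearMap.ker (LinearMap.toSpanSingleton R (D.obj k) (D.map f y)) := by
    rw [← hs, Submodule.span_le]
    exact fun a ha ↦ hf a ha
  have hy : D.map f y = 0 := by
    have := LinearMap.congr_fun
      (hquot _ (hD k) ((LinearMap.ker φ).liftQ _ hker)) (Submodule.Quotient.mk 1)
    rwa [Submodule.liftQ_apply, LinearMap.toSpanSingleton_apply, one_smul] at this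
  rw [← c.w f, ConcreteCategory.comp_apply, hy, map_zero]

/-- If the torsion-free class is closed under direct limits, every element of a torsion module
over a Noetherian ring lies in a finitely generated torsion submodule. -/
theorem exists_fg_torsion_submodule [IsNoetherianRing R] (htp : ModTorsionPair R T F)
    (hF : ClosedUnderDirectLimits R F) {M : ModuleCat.{u} R} (hM : T M) (x : M) :
    ∃ N : Submodule R M, N.FG ∧ x ∈ N ∧ IsLeftOrthogonal R F N := by
  classical
  let ι := {N : Submodule R M // N.FG}
  choose t ht hQ using fun N : ι ↦ htp.exists_torsion_submodule (ModuleCat.of R N.1)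
  have hle (N₁ N₂ : ι) (h : N₁ ≤ N₂) : t N₁ ≤ (t N₂).comap (Module.fgSystem R M N₁ N₂ h) := by
    intro y hy
    have := htp.hom_eq_zero (ht N₁) (hQ N₂)
      ((t N₂).mkQ ∘ₗ Module.fgSystem R M N₁ N₂ h ∘ₗ (t N₁).subtype)
    exact (Submodule.Quotient.mk_eq_zero (t N₂)).mp (LinearMap.congr_fun this ⟨y, hy⟩)
  let G (N : ι) : Type u := N.1 ⧸ t N
  let g (N₁ N₂ : ι) (h : N₁ ≤ N₂) : G N₁ →ₗ[R] G N₂ :=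
    (t N₁).mapQ (t N₂) (Module.fgSystem R M N₁ N₂ h) (hle N₁ N₂ h)
  have : DirectedSystem G (g · · ·) := {
    map_self := fun N z ↦ by
      obtain ⟨z, rfl⟩ := Submodule.mkQ_surjective _ z
      rfl
    map_map := fun _ _ _ _ _ z ↦ by
      obtain ⟨z, rfl⟩ := Submodule.mkQ_surjective _ z
      rfl }
  have hne : Nonempty ι := ⟨⟨⊥, Submodule.fg_bot⟩⟩
  have hlim : F (ModuleCat.of R (Module.DirectLimit G g)) :=
    hF ι (ModuleCat.directLimitDiagram G g) _ (ModuleCat.directLimitIsColimit G g) hQ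
  let π : Module.DirectLimit _ (Module.fgSystem R M) →ₗ[R] Module.DirectLimit G g :=
    Module.DirectLimit.map (fun N ↦ (t N).mkQ) fun N₁ N₂ h ↦ rfl
  have hπ : π = 0 := by
    have := htp.hom_eq_zero hM hlim (π ∘ₗ (Module.fgSystem.equiv R M).symm.toLinearMap)
    refine LinearMap.ext fun z ↦ ?_
    simpa using LinearMap.congr_fun this (Module.fgSystem.equiv R M z)
  let N : ι := ⟨R ∙ x, Submodule.fg_span_singleton x⟩
  let x' : N.1 := ⟨x, Submodule.mem_span_singleton_self x⟩
  have hx : Module.DirectLimit.of R ι G g N ((t N).mkQ x') = 0 := by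
    rw [← Module.DirectLimit.map_apply_of (f := Module.fgSystem R M) (fun N ↦ (t N).mkQ)
      fun _ _ _ ↦ rfl]
    exact LinearMap.congr_fun hπ _
  obtain ⟨N', hNN', hx'⟩ := Module.DirectLimit.of.zero_exact hx
  have : Module.Finite R N'.1 := Module.Finite.iff_fg.mpr N'.2
  refine ⟨(t N').map N'.1.subtype, (IsNoetherian.noetherian (t N')).map _,
    ⟨Submodule.inclusion hNN' x', (Submodule.Quotient.mk_eq_zero (t N')).mp hx', rfl⟩, ?_⟩
  let e := Submodule.equivMapOfInjective N'.1.subtype N'.1.injective_subtype (t N')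
  exact (htp.isLeftOrthogonal (ht N')).of_surjective e.toLinearMap e.surjective

theorem hereditaryClass [IsNoetherianRing R] (htp : ModTorsionPair R T F)
    (hF : ClosedUnderDirectLimits R F) : HereditaryClass R T := by
  intro M hM L
  refine htp.torsion_of_isLeftOrthogonal fun Y hY f ↦ LinearMap.ext fun x ↦ ?_
  obtain ⟨N, hN, hxN, hNF⟩ := htp.exists_fg_torsion_submodule hF hM x
  have : Module.Finite R N := Module.Finite.iff_fg.mpr hN
  have hmap := hNF.of_injective_of_finite (Submodule.inclusion (inf_le_right : L ⊓ N ≤ N))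
    (Submodule.inclusion_injective _)
  exact LinearMap.congr_fun (hmap Y hY (f ∘ₗ Submodule.inclusion inf_le_left)) ⟨x, x.2, hxN⟩

end ModTorsionPair

variable (R)

/-- **Corollary.** Over a commutative Noetherian ring, a torsion pair is hereditary if
and only if its torsion-free class is closed under direct limits. -/
theorem comm_noetherian_hereditary_iff_closed_direct_limits [IsNoetherianRing R]
    (T F : ModuleCat.{u} R → Prop) (htp : ModTorsionPair R T F) :
    HereditaryClass R T ↔ ClosedUnderDirectLimits R F :=
  ⟨htp.closedUnderDirectLimits, htp.hereditaryClass⟩
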